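/- arXiv:2110.12436 — 6 statements merged into one kernel-verified Lean document; each statement's English description precedes it below -/
import Mathlib

section
/- Let n ≥ 1 and let E_1, …, E_n be finite-dimensional complex inner product spaces, E = E_1 × ⋯ × E_n. Fix a real number t ≥ 0 and an integer k ≥ 2, and define G : E → ℝ by G(v) = (1/(1+t))·( Σ_{l=1}^n ‖v_l‖² + t·( Σ_{l=1}^n ‖v_l‖^{2k} )^{1/k} ), where v = (v_1,…,v_n). Then G is C^∞ (as a function of the underlying real vector space) on E \ {0}, and for every v ≠ 0 the second real Fréchet derivative of G at v is positive definite: D²G(v)(w,w) > 0 for every w ≠ 0. (This is the fiberwise statement that the complex Finsler metric F_{t,k} = √G is strongly convex.) -/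
open Filter Topology in
/-- The second Fréchet derivative on the diagonal is the second derivative along a line. -/
theorem iteratedFDeriv_two_eq_of_hasDerivAt_line {V : Type*} [NormedAddCommGroup V]
    [NormedSpace ℝ V] {f : V → ℝ} {v w : V} (hf : ContDiffAt ℝ 2 f v) {g : ℝ → ℝ} {c : ℝ}
    (hg : ∀ᶠ s in 𝓝 (0 : ℝ), HasDerivAt (fun r : ℝ => f (v + r • w)) (g s) s)
    (hc : HasDerivAt g c 0) : iteratedFDeriv ℝ 2 f v ![w, w] = c := by
  have hline : ∀ s : ℝ, HasDerivAt (fun r : ℝ => v + r • w) w s := fun s => by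
    simpa using ((hasDerivAt_id s).smul_const w).const_add v
  have htend : Tendsto (fun r : ℝ => v + r • w) (𝓝 0) (𝓝 v) := by
    simpa using (hline 0).continuousAt.tendsto
  have hdiff : ∀ᶠ x in 𝓝 v, DifferentiableAt ℝ f x :=
    (hf.eventually (by simp)).mono fun x hx => hx.differentiableAt (by simp)
  have heq : (fun s : ℝ => fderiv ℝ f (v + s • w) w) =ᶠ[𝓝 0] g := by
    filter_upwards [htend.eventually hdiff, hg] with s hs hgs
    exact (hs.hasFDerivAt.comp_hasDerivAt s (hline s)).unique hgs
  have h2 : DifferentiableAt ℝ (fderiv ℝ f) v :=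
    (hf.fderiv_right (m := 1) (by norm_num)).differentiableAt (by simp)
  have h2' : HasFDerivAt (fderiv ℝ f) (fderiv ℝ (fderiv ℝ f) v) (v + (0 : ℝ) • w) := by
    simpa using h2.hasFDerivAt
  have h3 : HasDerivAt (fun s : ℝ => fderiv ℝ f (v + s • w) w) (fderiv ℝ (fderiv ℝ f) v w w) 0 := by
    have h4 : HasDerivAt (fun s : ℝ => fderiv ℝ f (v + s • w)) (fderiv ℝ (fderiv ℝ f) v w) 0 :=
      h2'.comp_hasDerivAt (0 : ℝ) (hline 0)
    exact (ContinuousLinearMap.apply ℝ ℝ w).hasFDerivAt.comp_hasDerivAt (0 : ℝ) h4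
  rw [iteratedFDeriv_two_apply]
  exact h3.unique (hc.congr_of_eventuallyEq heq)

theorem norm_add_real_smul_sq {V : Type*} [NormedAddCommGroup V] [InnerProductSpace ℂ V]
    (x y : V) (s : ℝ) :
    ‖x + s • y‖ ^ 2 = ‖x‖ ^ 2 + 2 * (inner ℂ x y).re * s + ‖y‖ ^ 2 * s ^ 2 := by
  rw [norm_add_sq (𝕜 := ℂ), norm_smul, mul_pow, Real.norm_eq_abs, sq_abs,
    ← Complex.coe_smul, inner_smul_right]
  simp
  ring

/-- The Cauchy–Schwarz inequality behind the convexity of the squared `ℓ^{2k}` norm. -/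
theorem sum_pow_mul_sq_le {ι : Type*} (s : Finset ι) (a b : ι → ℝ) (ha : ∀ i, 0 ≤ a i) (m : ℕ) :
    (∑ i ∈ s, a i ^ (m + 1) * b i) ^ 2 ≤
      (∑ i ∈ s, a i ^ (m + 2)) * ∑ i ∈ s, a i ^ m * b i ^ 2 :=
  Finset.sum_sq_le_sum_mul_sum_of_sq_le_mul s (fun i _ => pow_nonneg (ha i) _)
    (fun i _ => mul_nonneg (pow_nonneg (ha i) _) (sq_nonneg _)) (fun i _ => le_of_eq (by ring))

/-- Nonnegativity of the second derivative of `S ^ (1 / (m + 2))` where `S = ∑ p_i ^ (m + 2)` and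
`p_i` has value `a i`, slope `b i` and second derivative `2 * c i`. -/
theorem second_deriv_rpow_sum_nonneg {ι : Type*} (s : Finset ι) (a b c : ι → ℝ)
    (ha : ∀ i, 0 ≤ a i) (hc : ∀ i, 0 ≤ c i) (m : ℕ) (hS : 0 < ∑ i ∈ s, a i ^ (m + 2)) :
    0 ≤ (∑ i ∈ s, ((m + 2 : ℝ) * ((m + 1 : ℝ) * a i ^ m * b i) * b i +
            (m + 2 : ℝ) * a i ^ (m + 1) * (2 * c i))) *
          (1 / (m + 2 : ℝ)) * (∑ i ∈ s, a i ^ (m + 2)) ^ (1 / (m + 2 : ℝ) - 1) +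
        (∑ i ∈ s, (m + 2 : ℝ) * a i ^ (m + 1) * b i) * (1 / (m + 2 : ℝ)) *
          ((∑ i ∈ s, (m + 2 : ℝ) * a i ^ (m + 1) * b i) * (1 / (m + 2 : ℝ) - 1) *
            (∑ i ∈ s, a i ^ (m + 2)) ^ (1 / (m + 2 : ℝ) - 1 - 1)) := by
  have hcs := sum_pow_mul_sq_le s a b ha m
  have h1 : ∑ i ∈ s, ((m + 2 : ℝ) * ((m + 1 : ℝ) * a i ^ m * b i) * b i +
      (m + 2 : ℝ) * a i ^ (m + 1) * (2 * c i)) =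
      (m + 2 : ℝ) * (m + 1) * (∑ i ∈ s, a i ^ m * b i ^ 2) +
        (m + 2 : ℝ) * 2 * ∑ i ∈ s, a i ^ (m + 1) * c i := by
    simp only [Finset.mul_sum, ← Finset.sum_add_distrib]
    exact Finset.sum_congr rfl fun i _ => by ring
  have h2 : ∑ i ∈ s, (m + 2 : ℝ) * a i ^ (m + 1) * b i =
      (m + 2 : ℝ) * ∑ i ∈ s, a i ^ (m + 1) * b i := by
    rw [Finset.mul_sum]
    exact Finset.sum_congr rfl fun i _ => by ring
  have hC : 0 ≤ ∑ i ∈ s, a i ^ (m + 1) * c i :=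
    Finset.sum_nonneg fun i _ => mul_nonneg (pow_nonneg (ha i) _) (hc i)
  rw [h1, h2]
  generalize (∑ i ∈ s, a i ^ (m + 2)) = S at *
  generalize (∑ i ∈ s, a i ^ (m + 1) * b i) = B at *
  generalize (∑ i ∈ s, a i ^ m * b i ^ 2) = A at *
  generalize (∑ i ∈ s, a i ^ (m + 1) * c i) = C at *
  have hpow : S ^ (1 / (m + 2 : ℝ) - 1) = S ^ (1 / (m + 2 : ℝ) - 1 - 1) * S := by
    conv_rhs => rw [Real.rpow_sub_one hS.ne']
    field_simp
  have hR : 0 ≤ S ^ (1 / (m + 2 : ℝ) - 1 - 1) := (Real.rpow_pos_of_pos hS _).le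
  rw [hpow]
  generalize S ^ (1 / (m + 2 : ℝ) - 1 - 1) = R at *
  have hm : (m + 2 : ℝ) ≠ 0 := by positivity
  have : 0 ≤ R * ((m + 1 : ℝ) * (S * A - B ^ 2) + 2 * S * C) :=
    mul_nonneg hR (add_nonneg (mul_nonneg (by positivity) (by linarith)) (by positivity))
  refine this.trans_eq ?_
  field_simp
  ring

theorem sum_norm_pow_pos {ι : Type*} [Fintype ι] {E : ι → Type*} [∀ l, NormedAddCommGroup (E l)]
    {v : ∀ l, E l} (hv : v ≠ 0) (m : ℕ) : 0 < ∑ l, ‖v l‖ ^ m := by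
  obtain ⟨j, hj⟩ := Function.ne_iff.mp hv
  exact Finset.sum_pos' (fun i _ => by positivity)
    ⟨j, Finset.mem_univ j, pow_pos (norm_pos_iff.mpr hj) m⟩


/-- Fiberwise strong convexity of `F_{t,k}`: on a product `E = E₁ × ⋯ × E_n` of
finite-dimensional complex inner product spaces, the function
`G(v) = (1/(1+t))·(∑ ‖v_l‖² + t·(∑ ‖v_l‖^{2k})^{1/k})` is `C^∞` away from `0`, and its
second real Fréchet derivative is positive definite at every `v ≠ 0`. -/
theorem ftk_strongly_convex (n : ℕ) (hn : 1 ≤ n) (E : Fin n → Type*)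
    [∀ l, NormedAddCommGroup (E l)] [∀ l, InnerProductSpace ℂ (E l)]
    [∀ l, FiniteDimensional ℂ (E l)]
    (t : ℝ) (ht : 0 ≤ t) (k : ℕ) (hk : 2 ≤ k)
    (G : (∀ l, E l) → ℝ)
    (hG : G = fun v => (1 / (1 + t)) *
      ((∑ l, ‖v l‖ ^ 2) + t * (∑ l, ‖v l‖ ^ (2 * k)) ^ ((1 : ℝ) / k))) :
    ContDiffOn ℝ (⊤ : ℕ∞) G {v : ∀ l, E l | v ≠ 0} ∧
      ∀ v : ∀ l, E l, v ≠ 0 → ∀ w : ∀ l, E l, w ≠ 0 →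
        0 < iteratedFDeriv ℝ 2 G v ![w, w] := by
  have hnorm : ∀ l, ContDiff ℝ (⊤ : ℕ∞) (fun v : ∀ l, E l => ‖v l‖ ^ 2) := fun l =>
    (contDiff_norm_sq ℂ).comp (ContinuousLinearMap.proj (R := ℝ) (φ := E) l).contDiff
  have hsmooth : ∀ v : ∀ l, E l, v ≠ 0 → ContDiffAt ℝ (⊤ : ℕ∞) G v := by
    intro v hv
    rw [hG]
    have hS : ContDiff ℝ (⊤ : ℕ∞) (fun v : ∀ l, E l => ∑ l, ‖v l‖ ^ (2 * k)) := by
      simp only [pow_mul]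
      exact ContDiff.sum fun l _ => (hnorm l).pow k
    exact contDiffAt_const.mul ((ContDiff.sum fun l _ => hnorm l).contDiffAt.add
      (contDiffAt_const.mul (hS.contDiffAt.rpow_const_of_ne (sum_norm_pow_pos hv _).ne')))
  refine ⟨fun v hv => (hsmooth v hv).contDiffWithinAt, fun v hv w hw => ?_⟩
  obtain ⟨m, rfl⟩ : ∃ m, k = m + 2 := ⟨k - 2, by omega⟩
  have hk0 : (((m + 2 : ℕ) : ℝ)) = (m + 2 : ℝ) := by push_cast; ring
  let p : Fin n → ℝ → ℝ := fun l s =>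
    ‖v l‖ ^ 2 + 2 * (inner ℂ (v l) (w l)).re * s + ‖w l‖ ^ 2 * s ^ 2
  let q : Fin n → ℝ → ℝ := fun l s => 2 * (inner ℂ (v l) (w l)).re + 2 * ‖w l‖ ^ 2 * s
  have hp : ∀ l s, HasDerivAt (p l) (q l s) s := fun l s => by
    have := (((hasDerivAt_id s).const_mul (2 * (inner ℂ (v l) (w l)).re)).const_add
      (‖v l‖ ^ 2)).add (((hasDerivAt_id s).pow 2).const_mul (‖w l‖ ^ 2))
    refine this.congr_deriv ?_
    simp [q]
    ring
  have hq : ∀ l s, HasDerivAt (q l) (2 * ‖w l‖ ^ 2) s := fun l s => by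
    simpa [q] using ((hasDerivAt_id s).const_mul (2 * ‖w l‖ ^ 2)).const_add
      (2 * (inner ℂ (v l) (w l)).re)
  have hSd : ∀ s, HasDerivAt (fun s => ∑ l, p l s ^ (m + 2))
      (∑ l, (m + 2 : ℝ) * p l s ^ (m + 1) * q l s) s := fun s =>
    HasDerivAt.fun_sum fun l _ => ((hp l s).pow (m + 2)).congr_deriv (by simp)
  have hSd' : HasDerivAt (fun s => ∑ l, (m + 2 : ℝ) * p l s ^ (m + 1) * q l s)
      (∑ l, ((m + 2 : ℝ) * ((m + 1 : ℝ) * p l 0 ^ m * q l 0) * q l 0 +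
        (m + 2 : ℝ) * p l 0 ^ (m + 1) * (2 * ‖w l‖ ^ 2))) 0 :=
    HasDerivAt.fun_sum fun l _ =>
      ((((hp l 0).pow (m + 1)).const_mul (m + 2 : ℝ)).mul (hq l 0)).congr_deriv (by simp)
  have hline : ∀ s : ℝ, G (v + s • w) = 1 / (1 + t) *
      (∑ l, p l s + t * (∑ l, p l s ^ (m + 2)) ^ (1 / (m + 2 : ℝ))) := fun s => by
    rw [hG]
    simp only [pow_mul, Pi.add_apply, Pi.smul_apply, norm_add_real_smul_sq, hk0, p]
  have hp0 : ∀ l, p l 0 = ‖v l‖ ^ 2 := fun l => by simp [p]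
  have hS0 : 0 < ∑ l, p l 0 ^ (m + 2) := by
    simpa only [hp0, ← pow_mul] using sum_norm_pow_pos hv (2 * (m + 2))
  have hd1 : ∀ᶠ s in nhds (0 : ℝ), HasDerivAt (fun r : ℝ => G (v + r • w))
      (1 / (1 + t) * (∑ l, q l s + t * ((∑ l, (m + 2 : ℝ) * p l s ^ (m + 1) * q l s) *
        (1 / (m + 2 : ℝ)) * (∑ l, p l s ^ (m + 2)) ^ (1 / (m + 2 : ℝ) - 1)))) s := by
    filter_upwards [(hSd 0).continuousAt.eventually (lt_mem_nhds hS0)] with s hs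
    simp only [hline]
    exact ((HasDerivAt.fun_sum fun l _ => hp l s).add
      (((hSd s).rpow_const (Or.inl hs.ne')).const_mul t)).const_mul _
  have hd2 := ((HasDerivAt.fun_sum fun l (_ : l ∈ Finset.univ) => hq l 0).add
    (((hSd'.mul_const (1 / (m + 2 : ℝ))).mul ((hSd 0).rpow_const
      (p := 1 / (m + 2 : ℝ) - 1) (Or.inl hS0.ne'))).const_mul t)).const_mul (1 / (1 + t))
  rw [iteratedFDeriv_two_eq_of_hasDerivAt_line ((hsmooth v hv).of_le (WithTop.coe_le_coe.mpr (le_top : (2 : ℕ∞) ≤ ⊤)))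
    hd1 hd2]
  have hW : 0 < ∑ l, 2 * ‖w l‖ ^ 2 := by
    rw [← Finset.mul_sum]
    exact mul_pos two_pos (sum_norm_pow_pos hw 2)
  refine mul_pos (by positivity) (add_pos_of_pos_of_nonneg hW (mul_nonneg ht ?_))
  exact second_deriv_rpow_sum_nonneg Finset.univ (fun l => p l 0) (fun l => q l 0)
    (fun l => ‖w l‖ ^ 2) (fun l => by rw [hp0]; positivity) (fun l => by positivity) m hS0
end

section
/- Let n ≥ 1 be an integer, k ≥ 2 an integer, t ≥ 0 a real number, and let Q_1, …, Q_n be nonnegative real numbers, not all zero. Set A = Σ_{l=1}^n Q_l^k (so A > 0), S₁ = Σ_l Q_l, S₂ = Σ_l Q_l², and S_{k+1} = Σ_l Q_l^{k+1}. Then the following double inequality holds: (1+t)·( S₂ + t·A^{(1/k)−1}·S_{k+1} ) ≤ ( S₁ + t·A^{1/k} )² ≤ ( n + t·n^{1/k} )·( S₂ + t·A^{(1/k)−1}·S_{k+1} ). (This is the key estimate showing that the holomorphic sectional curvature K_{t,k} of F_{t,k} satisfies K_{t,k} ∈ [ (1+t)c/(n + t·n^{1/k}), c ] when each factor has constant holomorphic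 sectional curvature c > 0, and K_{t,k} ∈ [ c, (1+t)c/(n + t·n^{1/k}) ] when c < 0.) -/
section NormalizedSums

variable {ι : Type*} [Fintype ι] {k : ℕ} {x : ι → ℝ}

theorem le_one_of_sum_pow_eq_one (hk : k ≠ 0) (hx : ∀ l, 0 ≤ x l) (hs : ∑ l, x l ^ k = 1)
    (l : ι) : x l ≤ 1 := by
  have h : x l ^ k ≤ 1 := hs ▸
    Finset.single_le_sum (f := fun l => x l ^ k) (fun i _ => pow_nonneg (hx i) k) (Finset.mem_univ l)
  exact (pow_le_one_iff_of_nonneg (hx l) hk).1 h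

theorem sum_pow_pred_le_card_rpow (hk : 2 ≤ k) (hx : ∀ l, 0 ≤ x l) (hs : ∑ l, x l ^ k = 1) :
    ∑ l, x l ^ (k - 1) ≤ (Fintype.card ι : ℝ) ^ ((1 : ℝ) / k) := by
  have hk1 : (1 : ℝ) < k := by exact_mod_cast hk
  have hpow : ∀ l, |x l ^ (k - 1)| ^ Real.conjExponent (k : ℝ) = x l ^ k := fun l => by
    have hexp : ((k - 1 : ℕ) : ℝ) * Real.conjExponent (k : ℝ) = k := by
      rw [Real.conjExponent, Nat.cast_sub (by omega), Nat.cast_one]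
      field_simp [sub_ne_zero.2 hk1.ne']
    rw [abs_of_nonneg (pow_nonneg (hx l) _), ← Real.rpow_natCast, ← Real.rpow_mul (hx l), hexp,
      Real.rpow_natCast]
  have h := Real.inner_le_Lp_mul_Lq Finset.univ (fun _ => (1 : ℝ)) (fun l => x l ^ (k - 1))
    (Real.HolderConjugate.conjExponent hk1)
  simp only [hpow, hs] at h
  simpa using h

theorem one_add_mul_sum_le_sq (hk : 2 ≤ k) {t : ℝ} (ht : 0 ≤ t) (hx : ∀ l, 0 ≤ x l)
    (hs : ∑ l, x l ^ k = 1) :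
    (1 + t) * ((∑ l, x l ^ 2) + t * ∑ l, x l ^ (k + 1)) ≤ ((∑ l, x l) + t) ^ 2 := by
  have hx1 := le_one_of_sum_pow_eq_one (by omega) hx hs
  have hle : ∀ m, m ≠ 0 → ∑ l, x l ^ m ≤ ∑ l, x l := fun m hm =>
    Finset.sum_le_sum fun l _ => pow_le_of_le_one (hx l) (hx1 l) hm
  have hsq : ∑ l, x l ^ 2 ≤ (∑ l, x l) ^ 2 :=
    Finset.sum_sq_le_sq_sum_of_nonneg fun l _ => hx l
  have htop : ∑ l, x l ^ (k + 1) ≤ 1 := hs ▸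
    Finset.sum_le_sum fun l _ => pow_le_pow_of_le_one (hx l) (hx1 l) k.le_succ
  nlinarith [mul_le_mul_of_nonneg_left (hle 2 two_ne_zero) ht,
    mul_le_mul_of_nonneg_left (hle (k + 1) k.succ_ne_zero) ht,
    mul_le_mul_of_nonneg_left htop (sq_nonneg t)]

theorem sq_le_card_add_mul_sum (hk : 2 ≤ k) {t : ℝ} (ht : 0 ≤ t) (hx : ∀ l, 0 ≤ x l)
    (hs : ∑ l, x l ^ k = 1) :
    ((∑ l, x l) + t) ^ 2 ≤ (Fintype.card ι + t * (Fintype.card ι : ℝ) ^ ((1 : ℝ) / k)) *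
      ((∑ l, x l ^ 2) + t * ∑ l, x l ^ (k + 1)) := by
  have hw : ∀ l, 0 ≤ 1 + t * x l ^ (k - 1) := fun l => by have := hx l; positivity
  have hpow : ∀ l, x l ^ (k - 1) * x l = x l ^ k := fun l => pow_sub_one_mul (by omega) _
  have hpow' : ∀ l, x l ^ (k - 1) * x l ^ 2 = x l ^ (k + 1) := fun l => by
    rw [← pow_add]; congr 1; omega
  have cs := Finset.sum_sq_le_sum_mul_sum_of_sq_le_mul Finset.univ
    (r := fun l => (1 + t * x l ^ (k - 1)) * x l) (f := fun l => 1 + t * x l ^ (k - 1))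
    (g := fun l => (1 + t * x l ^ (k - 1)) * x l ^ 2) (fun l _ => hw l)
    (fun l _ => mul_nonneg (hw l) (sq_nonneg _)) (fun l _ => le_of_eq (by ring))
  simp only [add_mul, one_mul, mul_assoc, hpow, hpow', Finset.sum_add_distrib, ← Finset.mul_sum,
    hs, mul_one, Finset.sum_const, Finset.card_univ, nsmul_eq_mul] at cs
  refine cs.trans ?_
  rw [← mul_assoc, ← add_mul]
  have := sum_pow_pred_le_card_rpow hk hx hs
  have : 0 ≤ (∑ l, x l ^ 2) + t * ∑ l, x l ^ (k + 1) :=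
    add_nonneg (Finset.sum_nonneg fun l _ => sq_nonneg _)
      (mul_nonneg ht (Finset.sum_nonneg fun l _ => pow_nonneg (hx l) _))
  gcongr

end NormalizedSums


/-- The key curvature estimate for `F_{t,k}`: with `A = ∑ Q_l^k`, `S₁ = ∑ Q_l`,
`S₂ = ∑ Q_l²`, `S_{k+1} = ∑ Q_l^{k+1}`, one has
`(1+t)(S₂ + t·A^{1/k−1}·S_{k+1}) ≤ (S₁ + t·A^{1/k})² ≤ (n + t·n^{1/k})(S₂ + t·A^{1/k−1}·S_{k+1})`. -/
theorem ftk_curvature_estimate (n k : ℕ) (hn : 1 ≤ n) (hk : 2 ≤ k)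
    (t : ℝ) (ht : 0 ≤ t)
    (Q : Fin n → ℝ) (hQ : ∀ l, 0 ≤ Q l) (hne : ∃ l, Q l ≠ 0) :
    (1 + t) * ((∑ l, Q l ^ 2) +
        t * (∑ l, Q l ^ k) ^ ((1 : ℝ) / k - 1) * ∑ l, Q l ^ (k + 1))
      ≤ ((∑ l, Q l) + t * (∑ l, Q l ^ k) ^ ((1 : ℝ) / k)) ^ 2 ∧
    ((∑ l, Q l) + t * (∑ l, Q l ^ k) ^ ((1 : ℝ) / k)) ^ 2
      ≤ ((n : ℝ) + t * (n : ℝ) ^ ((1 : ℝ) / k)) *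
        ((∑ l, Q l ^ 2) +
          t * (∑ l, Q l ^ k) ^ ((1 : ℝ) / k - 1) * ∑ l, Q l ^ (k + 1)) := by

  set a : ℝ := (∑ l, Q l ^ k) ^ ((1 : ℝ) / k) with ha
  have hA : 0 < ∑ l, Q l ^ k := by
    obtain ⟨l, hl⟩ := hne
    exact Finset.sum_pos' (fun i _ => pow_nonneg (hQ i) k)
      ⟨l, Finset.mem_univ l, pow_pos ((hQ l).lt_of_ne' hl) k⟩
  have ha0 : 0 < a := Real.rpow_pos_of_pos hA _
  have hak : a ^ k = ∑ l, Q l ^ k := by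
    rw [ha, one_div, Real.rpow_inv_natCast_pow hA.le (by omega)]
  have hcoef : (∑ l, Q l ^ k) ^ ((1 : ℝ) / k - 1) = a / a ^ k := by
    rw [Real.rpow_sub_one hA.ne', hak]
  have hx : ∀ l, 0 ≤ Q l / a := fun l => div_nonneg (hQ l) ha0.le
  have hsum : ∀ m, ∑ l, (Q l / a) ^ m = (∑ l, Q l ^ m) / a ^ m := fun m => by
    simp only [div_pow, Finset.sum_div]
  have hs : ∑ l, (Q l / a) ^ k = 1 := by
    rw [hsum, ← hak, div_self (pow_pos ha0 k).ne']
  have hnum : (∑ l, Q l ^ 2) + t * (a / a ^ k) * ∑ l, Q l ^ (k + 1) =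
      a ^ 2 * ((∑ l, (Q l / a) ^ 2) + t * ∑ l, (Q l / a) ^ (k + 1)) := by
    rw [hsum, hsum]
    field_simp
    ring
  have hden : (∑ l, Q l) + t * a = a * ((∑ l, Q l / a) + t) := by
    rw [← Finset.sum_div]
    field_simp
  rw [hcoef, hnum, hden, mul_pow, mul_left_comm, mul_left_comm _ (a ^ 2)]
  have hlow := one_add_mul_sum_le_sq hk ht hx hs
  have hupp := sq_le_card_add_mul_sum hk ht hx hs
  rw [Fintype.card_fin] at hupp
  constructor <;> gcongr
end

section
/- Let n ≥ 1, t ∈ [0,∞) a real number, k ≥ 2 an integer, and let P_n = {z ∈ ℂⁿ : |z^l| < 1 for l = 1,…,n} be the unit polydisk. Define F_{t,k}(z,v) = (1/√(1+t))·√( Σ_{l=1}^n |v^l|²/(1−|z^l|²)² + t·( Σ_{l=1}^n |v^l|^{2k}/(1−|z^l|²)^{2k} )^{1/k} ) for z ∈ P_n, v ∈ ℂⁿ. Let σ be a permutation of {1,…,n}, θ_1,…,θ_n ∈ ℝ, and a = (a_1,…,a_n) ∈ P_n, and define f : P_n → ℂⁿ by f_l(z) = e^{iθ_l}·(z^{σ(l)}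 − a_l)/(1 − conj(a_l)·z^{σ(l)}). Then f maps P_n into P_n, and for all z ∈ P_n and v ∈ ℂⁿ one has F_{t,k}( f(z), w ) = F_{t,k}(z,v), where w ∈ ℂⁿ is the image of v under the derivative of f at z, namely w^l = e^{iθ_l}·(1−|a_l|²)/(1 − conj(a_l)·z^{σ(l)})² · v^{σ(l)}. (Since every automorphism of P_n is of this form, F_{t,k} is Aut(P_n)-invariant.) -/
open ComplexConjugate in
/-- The Möbius identity `|1 - āz|² - |z - a|² = (1 - |a|²)(1 - |z|²)`. -/
theorem Complex.norm_sq_one_sub_conj_mul_sub (a z : ℂ) :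
    ‖1 - conj a * z‖ ^ 2 - ‖z - a‖ ^ 2 = (1 - ‖a‖ ^ 2) * (1 - ‖z‖ ^ 2) := by
  simp only [Complex.sq_norm, Complex.normSq_apply, Complex.sub_re, Complex.sub_im,
    Complex.mul_re, Complex.mul_im, Complex.one_re, Complex.one_im, Complex.conj_re,
    Complex.conj_im]
  ring

open ComplexConjugate in
theorem Complex.one_sub_conj_mul_ne_zero {a z : ℂ} (ha : ‖a‖ < 1) (hz : ‖z‖ < 1) :
    1 - conj a * z ≠ 0 := by
  intro h
  have h1 : ‖conj a * z‖ = 1 := by rw [← sub_eq_zero.mp h, norm_one]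
  rw [norm_mul, Complex.norm_conj] at h1
  nlinarith [norm_nonneg a, norm_nonneg z]

open ComplexConjugate in
/-- For a disk automorphism `φ`, `1 - |φ(z)|² = (1 - |a|²)(1 - |z|²) / |1 - āz|²`. -/
theorem Complex.one_sub_norm_sq_mobius {a z : ℂ} (ha : ‖a‖ < 1) (hz : ‖z‖ < 1) (θ : ℝ) :
    1 - ‖Complex.exp (θ * Complex.I) * (z - a) / (1 - conj a * z)‖ ^ 2 =
      (1 - ‖a‖ ^ 2) * (1 - ‖z‖ ^ 2) / ‖1 - conj a * z‖ ^ 2 := by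
  have hd : ‖1 - conj a * z‖ ≠ 0 := norm_ne_zero_iff.mpr (one_sub_conj_mul_ne_zero ha hz)
  rw [norm_div, norm_mul, Complex.norm_exp_ofReal_mul_I, one_mul,
    ← norm_sq_one_sub_conj_mul_sub, sub_div, div_pow, div_self (pow_ne_zero 2 hd)]

theorem one_sub_norm_sq_pos {E : Type*} [SeminormedAddGroup E] {x : E} (hx : ‖x‖ < 1) :
    0 < 1 - ‖x‖ ^ 2 := by
  nlinarith [norm_nonneg x]

open ComplexConjugate in
theorem Complex.norm_mobius_lt_one {a z : ℂ} (ha : ‖a‖ < 1) (hz : ‖z‖ < 1) (θ : ℝ) :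
    ‖Complex.exp (θ * Complex.I) * (z - a) / (1 - conj a * z)‖ < 1 := by
  have hd : 0 < ‖1 - conj a * z‖ := norm_pos_iff.mpr (one_sub_conj_mul_ne_zero ha hz)
  have hpos := div_pos (mul_pos (one_sub_norm_sq_pos ha) (one_sub_norm_sq_pos hz)) (pow_pos hd 2)
  rw [← one_sub_norm_sq_mobius ha hz θ, sub_pos] at hpos
  exact (pow_lt_one_iff_of_nonneg (norm_nonneg _) two_ne_zero).mp hpos

open ComplexConjugate in
/-- Disk automorphisms are isometries of the Poincaré metric `|v| / (1 - |z|²)`. -/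
theorem Complex.poincare_metric_mobius {a z : ℂ} (ha : ‖a‖ < 1) (hz : ‖z‖ < 1) (θ : ℝ) (v : ℂ) :
    ‖Complex.exp (θ * Complex.I) * (1 - (‖a‖ : ℂ) ^ 2) / (1 - conj a * z) ^ 2 * v‖ /
      (1 - ‖Complex.exp (θ * Complex.I) * (z - a) / (1 - conj a * z)‖ ^ 2) =
    ‖v‖ / (1 - ‖z‖ ^ 2) := by
  have hd : ‖1 - conj a * z‖ ≠ 0 := norm_ne_zero_iff.mpr (one_sub_conj_mul_ne_zero ha hz)
  have ha' := one_sub_norm_sq_pos ha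
  have hz' := one_sub_norm_sq_pos hz
  have hnum : ‖(1 - (‖a‖ : ℂ) ^ 2)‖ = 1 - ‖a‖ ^ 2 := by
    rw [← abs_of_pos ha', ← Real.norm_eq_abs, ← Complex.norm_real]
    push_cast
    rfl
  rw [one_sub_norm_sq_mobius ha hz, norm_mul, norm_div, norm_mul, norm_pow,
    Complex.norm_exp_ofReal_mul_I, one_mul, hnum]
  field_simp


/-- `Aut(P_n)`-invariance of the metrics `F_{t,k}` on the unit polydisk: every map of the
form `f_l(z) = e^{iθ_l}(z^{σ(l)} − a_l)/(1 − conj(a_l) z^{σ(l)})` maps `P_n` into `P_n`,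
and `F_{t,k}(f(z), Df(z)v) = F_{t,k}(z,v)`, where `(Df(z)v)^l =
e^{iθ_l}(1−|a_l|²)/(1 − conj(a_l) z^{σ(l)})² · v^{σ(l)}`. -/
theorem ftk_polydisk_aut_invariant (n : ℕ) (hn : 1 ≤ n) (t : ℝ) (ht : 0 ≤ t)
    (k : ℕ) (hk : 2 ≤ k)
    (σ : Equiv.Perm (Fin n)) (θ : Fin n → ℝ) (a : Fin n → ℂ) (ha : ∀ l, ‖a l‖ < 1) :
    let P : Set (Fin n → ℂ) := {z | ∀ l, ‖z l‖ < 1}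
    let F : (Fin n → ℂ) → (Fin n → ℂ) → ℝ := fun z v =>
      (1 / Real.sqrt (1 + t)) * Real.sqrt
        ((∑ l, ‖v l‖ ^ 2 / (1 - ‖z l‖ ^ 2) ^ 2) +
          t * (∑ l, ‖v l‖ ^ (2 * k) / (1 - ‖z l‖ ^ 2) ^ (2 * k)) ^ ((1 : ℝ) / k))
    let f : (Fin n → ℂ) → (Fin n → ℂ) := fun z l =>
      Complex.exp (θ l * Complex.I) * (z (σ l) - a l) /
        (1 - starRingEnd ℂ (a l) * z (σ l))
    let Df : (Fin n → ℂ) → (Fin n → ℂ) → (Fin n → ℂ) := fun z v l =>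
      Complex.exp (θ l * Complex.I) * (1 - (‖a l‖ : ℂ) ^ 2) /
        (1 - starRingEnd ℂ (a l) * z (σ l)) ^ 2 * v (σ l)
    (∀ z ∈ P, f z ∈ P) ∧
      ∀ z ∈ P, ∀ v : Fin n → ℂ, F (f z) (Df z v) = F z v := by
  intro P F f Df
  refine ⟨fun z hz l => Complex.norm_mobius_lt_one (ha l) (hz (σ l)) (θ l), fun z hz v => ?_⟩
  have hsum (m : ℕ) : ∑ l, ‖Df z v l‖ ^ m / (1 - ‖f z l‖ ^ 2) ^ m =
      ∑ l, ‖v l‖ ^ m / (1 - ‖z l‖ ^ 2) ^ m := by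
    rw [← Equiv.sum_comp σ fun l => ‖v l‖ ^ m / (1 - ‖z l‖ ^ 2) ^ m]
    refine Finset.sum_congr rfl fun l _ => ?_
    rw [← div_pow, ← div_pow]
    exact congrArg (· ^ m) (Complex.poincare_metric_mobius (ha l) (hz (σ l)) (θ l) (v (σ l)))
  simp only [F, hsum]
end

section
/- Let n ≥ 1, t ∈ [0,∞) a real number, k ≥ 2 an integer, s₀ > 0, and let r_1,…,r_n ∈ [0,1). Set a_l = (1/s₀)·log( (1+r_l)/(1−r_l) ) and x_l(s) = (e^{a_l s} − 1)/(e^{a_l s} + 1) for l = 1,…,n. Then ∫₀^{s₀} (1/√(1+t))·√( Σ_{l=1}^n ( x_l'(s)/(1−x_l(s)²) )² + t·( Σ_{l=1}^n ( x_l'(s)/(1−x_l(s)²) )^{2k} )^{1/k} ) ds = (1/(2√(1+t)))·√( Σ_{l=1}^n log²( (1+r_l)/(1−r_l) ) + t·( Σ_{l=1}^n log^{2k}( (1+r_l)/(1−r_l) ) )^{1/k} ). (This evaluates the F_{t,k}-length of the geodesic joining 0 and (r_1,…,r_n) in the unit polydisk and yields the geodesic distance formula for F_{t,k}.) -/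
/-- Along `x(s) = (e^{a s} − 1)/(e^{a s} + 1)`, the speed for the metric `|dx|/(1 − x²)` is
constantly `a / 2`. -/
theorem deriv_exp_sub_one_div_exp_add_one_div (a s : ℝ) :
    deriv (fun s : ℝ => (Real.exp (a * s) - 1) / (Real.exp (a * s) + 1)) s /
      (1 - ((Real.exp (a * s) - 1) / (Real.exp (a * s) + 1)) ^ 2) = a / 2 := by
  have hpos := Real.exp_pos (a * s)
  have hexp : HasDerivAt (fun s : ℝ => Real.exp (a * s)) (Real.exp (a * s) * a) s := by
    simpa using ((hasDerivAt_id s).const_mul a).exp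
  have hne : Real.exp (a * s) + 1 ≠ 0 := by positivity
  rw [((hexp.sub_const 1).fun_div (hexp.add_const 1) hne).deriv]
  have hden : 1 - ((Real.exp (a * s) - 1) / (Real.exp (a * s) + 1)) ^ 2 =
      4 * Real.exp (a * s) / (Real.exp (a * s) + 1) ^ 2 := by
    field_simp
    ring
  rw [hden]
  field_simp
  ring

/-- The metric `F_{t,k}` is homogeneous of degree one, up to its normalizing factor. -/
theorem sqrt_sum_sq_add_rpow_smul {ι : Type*} [Fintype ι] (t : ℝ) {k : ℕ} (hk : k ≠ 0)
    {c : ℝ} (hc : 0 ≤ c) (v : ι → ℝ) :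
    Real.sqrt ((∑ l, (c * v l) ^ 2) + t * (∑ l, (c * v l) ^ (2 * k)) ^ ((1 : ℝ) / k)) =
      c * Real.sqrt ((∑ l, v l ^ 2) + t * (∑ l, v l ^ (2 * k)) ^ ((1 : ℝ) / k)) := by
  have hsum : 0 ≤ ∑ l, v l ^ (2 * k) :=
    Finset.sum_nonneg fun l _ => (even_two_mul k).pow_nonneg (v l)
  have hroot : (c ^ (2 * k)) ^ ((1 : ℝ) / k) = c ^ 2 := by
    rw [pow_mul, one_div, Real.pow_rpow_inv_natCast (sq_nonneg c) hk]
  simp only [mul_pow, ← Finset.mul_sum]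
  rw [Real.mul_rpow (by positivity) hsum, hroot, mul_left_comm, ← mul_add,
    Real.sqrt_mul (sq_nonneg c), Real.sqrt_sq hc]


/-- The `F_{t,k}`-length of the geodesic joining `0` and `(r_1,…,r_n)` in the unit
polydisk: with `a_l = (1/s₀)·log((1+r_l)/(1−r_l))` and
`x_l(s) = (e^{a_l s} − 1)/(e^{a_l s} + 1)`, the integral of
`F_{t,k}(x(s), x'(s))` over `[0, s₀]` equals
`(1/(2√(1+t)))·√(∑ log²((1+r_l)/(1−r_l)) + t·(∑ log^{2k}((1+r_l)/(1−r_l)))^{1/k})`. -/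
theorem ftk_geodesic_distance_polydisk (n : ℕ) (hn : 1 ≤ n) (t : ℝ) (ht : 0 ≤ t)
    (k : ℕ) (hk : 2 ≤ k) (s₀ : ℝ) (hs₀ : 0 < s₀)
    (r : Fin n → ℝ) (hr : ∀ l, 0 ≤ r l ∧ r l < 1) :
    let a : Fin n → ℝ := fun l => (1 / s₀) * Real.log ((1 + r l) / (1 - r l))
    let x : Fin n → ℝ → ℝ := fun l s =>
      (Real.exp (a l * s) - 1) / (Real.exp (a l * s) + 1)
    (∫ s in (0 : ℝ)..s₀, (1 / Real.sqrt (1 + t)) * Real.sqrt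
        ((∑ l, (deriv (x l) s / (1 - x l s ^ 2)) ^ 2) +
          t * (∑ l, (deriv (x l) s / (1 - x l s ^ 2)) ^ (2 * k)) ^ ((1 : ℝ) / k)))
      = (1 / (2 * Real.sqrt (1 + t))) * Real.sqrt
        ((∑ l, Real.log ((1 + r l) / (1 - r l)) ^ 2) +
          t * (∑ l, Real.log ((1 + r l) / (1 - r l)) ^ (2 * k)) ^ ((1 : ℝ) / k)) := by
  intro a x
  have hspeed : ∀ l s, deriv (x l) s / (1 - x l s ^ 2) =
      1 / (2 * s₀) * Real.log ((1 + r l) / (1 - r l)) := fun l s => by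
    rw [show deriv (x l) s / (1 - x l s ^ 2) = a l / 2 from
      deriv_exp_sub_one_div_exp_add_one_div (a l) s]
    simp only [a]
    field_simp
  simp only [hspeed]
  rw [intervalIntegral.integral_const, sqrt_sum_sq_add_rpow_smul t (by lia) (by positivity),
    smul_eq_mul, sub_zero]
  have hsqrt : Real.sqrt (1 + t) ≠ 0 := by positivity
  field_simp
end

section
/- Let n ≥ 2 be an integer, t₁, t₂ ∈ [0,∞) real numbers, and k₁, k₂ ≥ 2 integers. Suppose that for every x = (x_1,…,x_n) ∈ [0,∞)ⁿ one has (1/(1+t₁))·( Σ_l x_l + t₁·( Σ_l x_l^{k₁} )^{1/k₁} ) = (1/(1+t₂))·( Σ_l x_l + t₂·( Σ_l x_l^{k₂} )^{1/k₂} ). Then t₁ = t₂, and moreover t₁ = 0 or k₁ = k₂. (This is the key computation showing that the complex Finsler manifolds (M, F_{t₁,k₁}) and (M, F_{t₂,k₂}) are not holomorphically isometric when t₁ ≠ t₂ or when t₁ = t₂ > 0 and k₁ ≠ k₂.) -/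
theorem one_le_one_add_pow_rpow {k : ℕ} {s : ℝ} (hs : 0 ≤ s) :
    1 ≤ (1 + s ^ k) ^ ((1 : ℝ) / k) :=
  Real.one_le_rpow (le_add_of_nonneg_right (pow_nonneg hs k)) (by positivity)

theorem one_add_pow_rpow_le {k : ℕ} (hk : 2 ≤ k) {s : ℝ} (hs : 0 ≤ s) (hs' : s ≤ 1) :
    (1 + s ^ k) ^ ((1 : ℝ) / k) ≤ 1 + s ^ 2 := by
  have h1 : (1 : ℝ) ≤ 1 + s ^ k := le_add_of_nonneg_right (pow_nonneg hs k)
  have h2 : (1 : ℝ) / k ≤ 1 := by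
    rw [div_le_one (by positivity)]
    exact_mod_cast (by omega : 1 ≤ k)
  calc (1 + s ^ k) ^ ((1 : ℝ) / k) ≤ (1 + s ^ k) ^ (1 : ℝ) :=
        Real.rpow_le_rpow_of_exponent_le h1 h2
    _ = 1 + s ^ k := Real.rpow_one _
    _ ≤ 1 + s ^ 2 := by
        gcongr 1 + ?_
        exact pow_le_pow_of_le_one hs hs' hk

theorem coeff_le_of_forall_defect_eq {a b : ℝ} (ha : 0 ≤ a) (hb : 0 ≤ b) {k l : ℕ} (hk : 2 ≤ k)
    (h : ∀ s : ℝ, 0 ≤ s →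
      a * (1 + s - (1 + s ^ k) ^ ((1 : ℝ) / k)) = b * (1 + s - (1 + s ^ l) ^ ((1 : ℝ) / l))) :
    a ≤ b := by
  by_contra! hab
  have ha0 : 0 < a := hb.trans_lt hab
  obtain ⟨s, hs⟩ : ∃ s, s = (a - b) / (2 * a) := ⟨_, rfl⟩
  have hs0 : 0 < s := hs ▸ div_pos (sub_pos.2 hab) (by positivity)
  have has : a * s = (a - b) / 2 := by rw [hs]; field_simp
  have hs1 : s ≤ 1 := by
    rw [hs, div_le_one (by positivity)]
    linarith
  have hlow : a * (s - s ^ 2) ≤ a * (1 + s - (1 + s ^ k) ^ ((1 : ℝ) / k)) :=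
    mul_le_mul_of_nonneg_left (by linarith [one_add_pow_rpow_le hk hs0.le hs1]) ha
  have hup : b * (1 + s - (1 + s ^ l) ^ ((1 : ℝ) / l)) ≤ b * s :=
    mul_le_mul_of_nonneg_left (by linarith [one_le_one_add_pow_rpow (k := l) hs0.le]) hb
  have hmul : s * (a - a * s) ≤ s * b := by linarith [h s hs0.le]
  have := le_of_mul_le_mul_left hmul hs0
  linarith

/-- Distinctness of the metrics `F_{t,k}`: if the fiberwise expressions of `F_{t₁,k₁}²`
and `F_{t₂,k₂}²` agree on all nonnegative inputs `(x_1,…,x_n)` with `n ≥ 2`, then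
`t₁ = t₂`, and moreover `t₁ = 0` or `k₁ = k₂`. -/
theorem ftk_parameters_determined (n : ℕ) (hn : 2 ≤ n)
    (t₁ t₂ : ℝ) (ht₁ : 0 ≤ t₁) (ht₂ : 0 ≤ t₂)
    (k₁ k₂ : ℕ) (hk₁ : 2 ≤ k₁) (hk₂ : 2 ≤ k₂)
    (heq : ∀ x : Fin n → ℝ, (∀ l, 0 ≤ x l) →
      (1 / (1 + t₁)) * ((∑ l, x l) + t₁ * (∑ l, x l ^ k₁) ^ ((1 : ℝ) / k₁))
        = (1 / (1 + t₂)) * ((∑ l, x l) + t₂ * (∑ l, x l ^ k₂) ^ ((1 : ℝ) / k₂))) :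
    t₁ = t₂ ∧ (t₁ = 0 ∨ k₁ = k₂) := by
  have defect : ∀ s : ℝ, 0 ≤ s →
      t₁ / (1 + t₁) * (1 + s - (1 + s ^ k₁) ^ ((1 : ℝ) / k₁))
        = t₂ / (1 + t₂) * (1 + s - (1 + s ^ k₂) ^ ((1 : ℝ) / k₂)) := by
    intro s hs
    obtain ⟨m, rfl⟩ := Nat.exists_eq_add_of_le' hn
    have h := heq (Fin.cons 1 (Fin.cons s fun _ => 0)) (by
      refine Fin.cases (by simp) (Fin.cases (by simpa using hs) (by simp)))
    simp only [Fin.sum_univ_succ, Fin.cons_zero, Fin.cons_succ, one_pow,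
      zero_pow (by omega : k₁ ≠ 0), zero_pow (by omega : k₂ ≠ 0),
      Finset.sum_const_zero, add_zero] at h
    have split : ∀ t p : ℝ, 0 ≤ t →
        1 / (1 + t) * (1 + s + t * p) = 1 + s - t / (1 + t) * (1 + s - p) := by
      intro t p ht
      field_simp
      ring
    rw [split _ _ ht₁, split _ _ ht₂] at h
    linarith
  have hcoeff : t₁ / (1 + t₁) = t₂ / (1 + t₂) :=
    le_antisymm
      (coeff_le_of_forall_defect_eq (by positivity) (by positivity) hk₁ defect)
      (coeff_le_of_forall_defect_eq (by positivity) (by positivity) hk₂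
        fun s hs => (defect s hs).symm)
  have ht : t₁ = t₂ := by
    rw [div_eq_div_iff (by positivity) (by positivity)] at hcoeff
    linarith
  refine ⟨ht, or_iff_not_imp_left.2 fun h0 => ?_⟩
  have hne : t₁ / (1 + t₁) ≠ 0 := div_ne_zero h0 (by positivity)
  have h := defect 1 zero_le_one
  rw [← hcoeff] at h
  have h' := mul_left_cancel₀ hne h
  simp only [one_pow, one_add_one_eq_two, sub_right_inj] at h'
  have hexp := (Real.rpow_right_inj two_pos (by norm_num)).1 h'
  simpa using hexp
end

section
/- Let n ≥ 1 be an integer, k ≥ 2 an integer, t ≥ 0 a real number, and let Q_1, …, Q_n be nonnegative real numbers, not all zero. Set A = Σ_{l=1}^n Q_l^k (so A > 0). Then 1 − Σ_{l=1}^n [ 2t(k−1)·A^{(1/k)−2}·Q_l^{2k−1} / ( 1 + t(2k−1)·A^{(1/k)−1}·Q_l^{k−1} ) ] = (1/A)·Σ_{l=1}^n [ (1 + t·A^{(1/k)−1}·Q_l^{k−1})·Q_l^k / ( 1 + t(2k−1)·A^{(1/k)−1}·Q_l^{k−1} ) ], and this common value is strictly positive. (This is the quantity 𝓒 arising in the Sherman–Morrison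 inversion of the real fundamental tensor of F_{t,k}, whose positivity is needed to compute the real geodesic spray coefficients and prove that F_{t,k} is a real Berwald metric.) -/
/-- The quantity `𝓒` from the Sherman–Morrison inversion of the real fundamental tensor
of `F_{t,k}`: with `A = ∑ Q_l^k > 0`,
`1 − ∑ 2t(k−1)A^{1/k−2}Q_l^{2k−1}/(1 + t(2k−1)A^{1/k−1}Q_l^{k−1})
  = (1/A)·∑ (1 + tA^{1/k−1}Q_l^{k−1})Q_l^k/(1 + t(2k−1)A^{1/k−1}Q_l^{k−1})`,
and this common value is strictly positive. -/
theorem ftk_real_sherman_morrison_scalar (n k : ℕ) (hn : 1 ≤ n) (hk : 2 ≤ k)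
    (t : ℝ) (ht : 0 ≤ t)
    (Q : Fin n → ℝ) (hQ : ∀ l, 0 ≤ Q l) (hne : ∃ l, Q l ≠ 0) :
    let A : ℝ := ∑ l, Q l ^ k
    (1 - ∑ l, (2 * t * ((k : ℝ) - 1) * A ^ ((1 : ℝ) / k - 2) * Q l ^ (2 * k - 1)) /
          (1 + t * (2 * (k : ℝ) - 1) * A ^ ((1 : ℝ) / k - 1) * Q l ^ (k - 1))
        = (1 / A) * ∑ l,
            ((1 + t * A ^ ((1 : ℝ) / k - 1) * Q l ^ (k - 1)) * Q l ^ k) /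
              (1 + t * (2 * (k : ℝ) - 1) * A ^ ((1 : ℝ) / k - 1) * Q l ^ (k - 1))) ∧
      0 < (1 / A) * ∑ l,
            ((1 + t * A ^ ((1 : ℝ) / k - 1) * Q l ^ (k - 1)) * Q l ^ k) /
              (1 + t * (2 * (k : ℝ) - 1) * A ^ ((1 : ℝ) / k - 1) * Q l ^ (k - 1)) := by
  intro A
  obtain ⟨j, hj⟩ := hne
  have hQj : 0 < Q j := lt_of_le_of_ne (hQ j) hj.symm
  have hA : 0 < A :=
    Finset.sum_pos' (fun l _ => pow_nonneg (hQ l) k) ⟨j, Finset.mem_univ j, pow_pos hQj k⟩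
  have hk1 : (2 : ℝ) ≤ k := by exact_mod_cast hk
  have hB : A ^ ((1 : ℝ) / k - 2) = A ^ ((1 : ℝ) / k - 1) / A := by
    rw [← Real.rpow_sub_one hA.ne']
    ring_nf
  rw [hB]
  have hB0 : 0 < A ^ ((1 : ℝ) / k - 1) := Real.rpow_pos_of_pos hA _
  generalize A ^ ((1 : ℝ) / k - 1) = B at hB0 ⊢
  have hD : ∀ l, 0 < 1 + t * (2 * (k : ℝ) - 1) * B * Q l ^ (k - 1) := fun l => by
    have h1 : 0 ≤ 2 * (k : ℝ) - 1 := by linarith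
    have h2 := pow_nonneg (hQ l) (k - 1)
    positivity
  have hN : ∀ l, 0 < 1 + t * B * Q l ^ (k - 1) := fun l => by
    have h2 := pow_nonneg (hQ l) (k - 1)
    positivity
  refine ⟨?_, mul_pos (one_div_pos.mpr hA) (Finset.sum_pos' (fun l _ => ?_)
    ⟨j, Finset.mem_univ j, div_pos (mul_pos (hN j) (pow_pos hQj k)) (hD j)⟩)⟩
  · have hone : (1 : ℝ) = ∑ l, Q l ^ k / A := by
      rw [← Finset.sum_div, div_self hA.ne']
    rw [Finset.mul_sum]
    nth_rewrite 1 [hone]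
    rw [← Finset.sum_sub_distrib]
    refine Finset.sum_congr rfl fun l _ => ?_
    have hpow : Q l ^ (2 * k - 1) = Q l ^ k * Q l ^ (k - 1) := by
      rw [← pow_add]
      congr 1
      omega
    have hDl := (hD l).ne'
    rw [hpow]
    generalize Q l ^ (k - 1) = q at hDl ⊢
    generalize Q l ^ k = p
    have hA' := hA.ne'
    generalize hd : 1 + t * (2 * (k : ℝ) - 1) * B * q = d at hDl ⊢
    field_simp
    rw [← hd]
    ring
  · exact div_nonneg (mul_nonneg (hN l).le (pow_nonneg (hQ l) k)) (hD l).le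
end
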